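/- arXiv:0905.0649 — 7 statements merged into one kernel-verified Lean document; each statement's English description precedes it below -/
import Mathlib

section
/- Let ε > 0, let x⁻, v⁻ ∈ ℝ² with ‖x⁻‖ = ε and ‖v⁻‖ = 1, let δ ∈ [0, 1/2], and let v : ℝ → ℝ² be continuous. Define x(t) := x⁻ + ∫₀ᵗ v(s) ds. Suppose τ > 0 satisfies ‖x(τ)‖ = ε and ‖v(s) − v⁻‖ ≤ δ for all s ∈ [0, τ], and suppose τ̂ > 0 satisfies ‖x⁻ + τ̂ • v⁻‖ = ε. Then |τ − τ̂| ≤ 32 ε δ. -/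
open scoped RealInnerProductSpace

/-- The exit time `τ` of a trajectory `x(t) = xm + ∫₀ᵗ v(s) ds` crossing the circle of
radius `ε`, whose velocity stays `δ`-close to the initial unit velocity `vm`, differs
from the straight-line exit time `τ'` by at most `32 ε δ`. -/
theorem exit_time_comparison (ε : ℝ) (hε : 0 < ε)
    (xm vm : EuclideanSpace ℝ (Fin 2))
    (hx : ‖xm‖ = ε) (hvm : ‖vm‖ = 1)
    (δ : ℝ) (hδ : δ ∈ Set.Icc (0 : ℝ) (1/2))
    (v : ℝ → EuclideanSpace ℝ (Fin 2)) (hvcont : Continuous v)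
    (τ : ℝ) (hτ : 0 < τ)
    (hxτ : ‖xm + ∫ s in (0:ℝ)..τ, v s‖ = ε)
    (hclose : ∀ s ∈ Set.Icc (0:ℝ) τ, ‖v s - vm‖ ≤ δ)
    (τ' : ℝ) (hτ' : 0 < τ')
    (hexit : ‖xm + τ' • vm‖ = ε) :
    |τ - τ'| ≤ 32 * ε * δ := by
  obtain ⟨hδ0, hδ1⟩ := hδ
  obtain ⟨e, he⟩ : ∃ e, e = ∫ s in (0:ℝ)..τ, (v s - vm) := ⟨_, rfl⟩
  have hd : ∫ s in (0:ℝ)..τ, v s = τ • vm + e := by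
    rw [he, intervalIntegral.integral_sub (hvcont.intervalIntegrable _ _)
      intervalIntegrable_const, intervalIntegral.integral_const, sub_zero]
    abel
  have hen : ‖e‖ ≤ τ * δ := by
    have h := intervalIntegral.norm_integral_le_of_norm_le_const
      (a := (0:ℝ)) (b := τ) (f := fun s => v s - vm) (C := δ) (fun s hs => by
        rw [Set.uIoc_of_le hτ.le] at hs
        exact hclose s ⟨hs.1.le, hs.2⟩)
    rw [sub_zero, abs_of_pos hτ] at h
    rw [he]
    linarith
  rw [hd] at hxτ
  -- The straight-line exit condition determines the exit time.
  have h1 : 2 * ⟪xm, vm⟫ + τ' = 0 := by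
    have h := norm_add_sq_real xm (τ' • vm)
    rw [hexit, hx, norm_smul, hvm, real_inner_smul_right, Real.norm_eq_abs, mul_one,
      sq_abs] at h
    have h' : τ' * (2 * ⟪xm, vm⟫ + τ') = 0 := by linarith
    exact (mul_eq_zero.mp h').resolve_left hτ'.ne'
  have h2 : τ * (τ - τ') = -(2 * ⟪xm, e⟫ + 2 * τ * ⟪vm, e⟫ + ‖e‖ ^ 2) := by
    have h := norm_add_sq_real xm (τ • vm + e)
    rw [hxτ, hx, norm_add_sq_real, norm_smul, hvm, inner_add_right, real_inner_smul_right,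
      real_inner_smul_left, Real.norm_eq_abs, mul_one, sq_abs] at h
    linear_combination -h - τ * h1
  have hτε : τ ≤ 4 * ε := by
    have ha : ‖τ • vm‖ = τ := by rw [norm_smul, hvm, Real.norm_eq_abs, abs_of_pos hτ, mul_one]
    have hb : ‖τ • vm‖ ≤ ‖xm + (τ • vm + e)‖ + ‖xm‖ + ‖e‖ := by
      have hc : τ • vm = (xm + (τ • vm + e)) - xm - e := by abel
      calc ‖τ • vm‖ = ‖(xm + (τ • vm + e)) - xm - e‖ := by rw [← hc]
        _ ≤ _ := (norm_sub_le _ _).trans (by gcongr; exact norm_sub_le _ _)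
    rw [ha, hxτ, hx] at hb
    nlinarith
  have h3 : |⟪xm, e⟫| ≤ ε * (τ * δ) :=
    (abs_real_inner_le_norm _ _).trans (by rw [hx]; gcongr)
  have h4 : |⟪vm, e⟫| ≤ τ * δ :=
    (abs_real_inner_le_norm _ _).trans (by rw [hvm, one_mul]; exact hen)
  have h5 : ‖e‖ ^ 2 ≤ (τ * δ) ^ 2 := by gcongr
  have h6 : τ * |τ - τ'| ≤ τ * (2 * ε * δ + 2 * τ * δ + τ * δ ^ 2) := by
    have h7 : τ * |τ - τ'| = |τ * (τ - τ')| := by rw [abs_mul, abs_of_pos hτ]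
    have h8 : |τ * ⟪vm, e⟫| ≤ τ * (τ * δ) := by
      rw [abs_mul, abs_of_pos hτ]; gcongr
    rw [h7, h2, abs_neg, abs_le]
    rw [abs_le] at h3 h8
    constructor <;> nlinarith [sq_nonneg ‖e‖, sq_nonneg (τ * δ)]
  have h9 := le_of_mul_le_mul_left h6 hτ
  have h10 : τ * δ ≤ 4 * ε * δ := by gcongr
  have h11 : τ * δ ^ 2 ≤ τ * δ := by
    gcongr
    nlinarith
  have h12 : 0 ≤ ε * δ := by positivity
  linarith
end

section
/- Let r > 0, Φ ≥ 0, c ∈ ℝ², and t₀ ≤ t₁ be real numbers with 8 r Φ ≤ 1/8. Let x : ℝ → ℝ² be differentiable with derivative v, and let v be differentiable on [t₀, t₁] with ‖v′(t)‖ ≤ Φ for all t ∈ [t₀, t₁]. Assume ‖v(t₀)‖ ≥ 1/2 and ‖x(t) − c‖ ≤ r for all t ∈ [t₀, t₁]. Then t₁ − t₀ ≤ 8 r, and ‖v(t) − v(t₀)‖ ≤ 8 r Φ for all t ∈ [t₀, t₁]. -/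
/-- Deterministic core of the crossing-time lemma: a particle whose speed at entry is at
least `1/2` and whose acceleration is bounded by `Φ` while it remains in the ball of
radius `r` around `c` must leave the ball within time `8r`, and its velocity changes by
at most `8rΦ` during that time. -/
theorem crossing_time_bound (r Φ : ℝ) (hr : 0 < r) (hΦ : 0 ≤ Φ)
    (c : EuclideanSpace ℝ (Fin 2)) (t₀ t₁ : ℝ) (ht : t₀ ≤ t₁)
    (hsmall : 8 * r * Φ ≤ 1/8)
    (x v a : ℝ → EuclideanSpace ℝ (Fin 2))
    (hx : ∀ t, HasDerivAt x (v t) t)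
    (hv : ∀ t ∈ Set.Icc t₀ t₁, HasDerivWithinAt v (a t) (Set.Icc t₀ t₁) t)
    (ha : ∀ t ∈ Set.Icc t₀ t₁, ‖a t‖ ≤ Φ)
    (hv0 : (1:ℝ)/2 ≤ ‖v t₀‖)
    (hball : ∀ t ∈ Set.Icc t₀ t₁, ‖x t - c‖ ≤ r) :
    t₁ - t₀ ≤ 8 * r ∧ ∀ t ∈ Set.Icc t₀ t₁, ‖v t - v t₀‖ ≤ 8 * r * Φ := by
  have hvel : ∀ t ∈ Set.Icc t₀ t₁, ‖v t - v t₀‖ ≤ Φ * (t - t₀) := by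
    intro t h
    have := (convex_Icc t₀ t₁).norm_image_sub_le_of_norm_hasDerivWithin_le hv ha
      (Set.left_mem_Icc.2 ht) h
    rwa [Real.norm_of_nonneg (sub_nonneg.2 h.1)] at this
  have htime : t₁ - t₀ ≤ 8 * r := by
    by_contra! hlt
    have hs : t₀ + 8 * r ∈ Set.Icc t₀ t₁ := ⟨by linarith, by linarith⟩
    have hdisp : ‖(x (t₀ + 8 * r) - (t₀ + 8 * r) • v t₀) - (x t₀ - t₀ • v t₀)‖
        ≤ 1 / 8 * ‖t₀ + 8 * r - t₀‖ := by
      refine (convex_Icc t₀ (t₀ + 8 * r)).norm_image_sub_le_of_norm_hasDerivWithin_le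
        (f := fun t => x t - t • v t₀) (f' := fun t => v t - v t₀) (fun t _ => ?_)
        (fun t h => ?_) (Set.left_mem_Icc.2 hs.1) (Set.right_mem_Icc.2 hs.1)
      · simpa using ((hx t).fun_sub ((hasDerivAt_id t).smul_const (v t₀))).hasDerivWithinAt
      · have := hvel t ⟨h.1, h.2.trans hs.2⟩
        nlinarith [h.2]
    have hsmul : (8 * r) • v t₀ = (x (t₀ + 8 * r) - c) - (x t₀ - c)
        - ((x (t₀ + 8 * r) - (t₀ + 8 * r) • v t₀) - (x t₀ - t₀ • v t₀)) := by
      module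
    have hnorm : ‖(8 * r) • v t₀‖ = 8 * r * ‖v t₀‖ := by
      rw [norm_smul, Real.norm_of_nonneg (by positivity)]
    rw [add_sub_cancel_left, Real.norm_of_nonneg (by positivity)] at hdisp
    have hle : ‖(8 * r) • v t₀‖ ≤ 3 * r := by
      rw [hsmul]
      linarith [norm_sub_le_of_le (norm_sub_le_of_le (hball _ hs)
        (hball t₀ (Set.left_mem_Icc.2 ht))) hdisp]
    nlinarith
  refine ⟨htime, fun t h => (hvel t h).trans ?_⟩
  nlinarith [h.2]
end

section
/- Let W : ℝ → ℝ be continuous with W(r) = 0 for all r ≥ 1, let ε > 0, α ∈ ℝ, and define the radial force field F_ε : ℝ² → ℝ² by F_ε(y) = −ε^{α−1} W(‖y‖/ε) · y/‖y‖ for y ≠ 0 and F_ε(0) = 0. Let b ∈ (−1,1), set x⁻ := ε·(−√(1−b²), b), v⁻ := (1,0), and τ̂ := 2ε√(1−b²). Then ⟨∫₀^{τ̂} F_ε(x⁻ + s • v⁻) ds, v⁻⟩ = 0; that is, the force integrated along the straight chord through the obstacle is perpendicular to the incoming velocity. -/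
open scoped RealInnerProductSpace

/-- The point of `ℝ²` with coordinates `a`, `b`. -/
noncomputable def vec2 (a b : ℝ) : EuclideanSpace ℝ (Fin 2) :=
  (EuclideanSpace.equiv (Fin 2) ℝ).symm ![a, b]

/-- A field of the form `y ↦ g ‖y‖ • y` commutes with every linear isometry. -/
theorem radial_field_comp_isometry {E : Type*} [NormedAddCommGroup E] [NormedSpace ℝ E]
    {F : E → E} {g : ℝ → ℝ} (hF : ∀ y, F y = g ‖y‖ • y) (R : E ≃ₗᵢ[ℝ] E) (y : E) :
    F (R y) = R (F y) := by
  rw [hF, hF, R.norm_map, map_smul]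

/-- If `F` commutes with the reflection `R` in the hyperplane orthogonal to `v` and `R` reverses
the path `γ` on `[0, T]`, then the integral of `F` along `γ` is orthogonal to `v`. -/
theorem inner_integral_eq_zero_of_reflection {E : Type*} [NormedAddCommGroup E]
    [InnerProductSpace ℝ E] [CompleteSpace E] {F : E → E} {γ : ℝ → E} {v : E} {T : ℝ}
    (hF : ∀ y, F ((ℝ ∙ v)ᗮ.reflection y) = (ℝ ∙ v)ᗮ.reflection (F y))
    (hγ : ∀ s, (ℝ ∙ v)ᗮ.reflection (γ s) = γ (T - s)) :
    ⟪∫ s in (0 : ℝ)..T, F (γ s), v⟫ = 0 := by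
  set R := (ℝ ∙ v)ᗮ.reflection
  set I := ∫ s in (0 : ℝ)..T, F (γ s) with hI
  have hRI : R I = I := by
    have hcomm : ∫ s in (0 : ℝ)..T, R (F (γ s)) = R I := by
      simp only [hI, intervalIntegral, map_sub]
      congr 1 <;> exact R.toContinuousLinearEquiv.integral_comp_comm _
    have hsymm := intervalIntegral.integral_comp_sub_left (a := 0) (b := T) (fun s => F (γ s)) T
    simp only [← hγ, hF, sub_self, sub_zero] at hsymm
    rw [← hcomm, hsymm]
  have h : ⟪I, v⟫ = -⟪I, v⟫ := by
    conv_lhs => rw [← R.inner_map_map, hRI,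
      Submodule.reflection_orthogonalComplement_singleton_eq_neg, inner_neg_right]
  linarith

/-- The radial force integrated along the straight chord through the obstacle is
perpendicular to the incoming velocity. -/
theorem chord_force_perpendicular (W : ℝ → ℝ) (hW : Continuous W)
    (hWsupp : ∀ r : ℝ, 1 ≤ r → W r = 0)
    (ε : ℝ) (hε : 0 < ε) (α : ℝ)
    (F : EuclideanSpace ℝ (Fin 2) → EuclideanSpace ℝ (Fin 2))
    (hF : ∀ y, y ≠ 0 → F y = -((ε ^ (α - 1) * W (‖y‖ / ε)) / ‖y‖) • y)
    (hF0 : F 0 = 0)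
    (b : ℝ) (hb : b ∈ Set.Ioo (-1 : ℝ) 1) :
    ⟪∫ s in (0:ℝ)..(2 * ε * Real.sqrt (1 - b^2)),
        F (ε • vec2 (-Real.sqrt (1 - b^2)) b + s • vec2 1 0),
      vec2 1 0⟫ = 0 := by
  apply inner_integral_eq_zero_of_reflection
    (γ := fun s => ε • vec2 (-Real.sqrt (1 - b^2)) b + s • vec2 1 0)
  · refine fun y => radial_field_comp_isometry
      (g := fun r => -((ε ^ (α - 1) * W (r / ε)) / r)) (fun y => ?_) _ y
    rcases eq_or_ne y 0 with rfl | hy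
    · rw [hF0, smul_zero]
    · exact hF y hy
  · intro s
    have hpath (s : ℝ) : ε • vec2 (-Real.sqrt (1 - b^2)) b + s • vec2 1 0 =
        (s - ε * Real.sqrt (1 - b^2)) • vec2 1 0 + (ε * b) • vec2 0 1 := by
      ext i
      fin_cases i <;> simp [vec2]
      ring
    have hperp : vec2 0 1 ∈ (ℝ ∙ vec2 1 0)ᗮ := by
      rw [Submodule.mem_orthogonal_singleton_iff_inner_right]
      simp [vec2, PiLp.inner_apply]
    simp only [hpath, map_add, map_smul,
      Submodule.reflection_orthogonalComplement_singleton_eq_neg,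
      Submodule.reflection_mem_subspace_eq_self hperp]
    module
end

section
/- Let V : ℝ → ℝ be twice continuously differentiable with V(r) = 0 for r ≥ 1 and V′(0) = 0, let α ∈ (0, 1/2], and let K > 0. Then there exist constants C > 0 and ε₀ ∈ (0,1) depending only on V, α, K such that the following holds for every ε ∈ (0, ε₀] and b ∈ [−1, 1]. Define F_ε : ℝ² → ℝ² by F_ε(y) = −ε^{α−1} V′(‖y‖/ε) · y/‖y‖ for y ≠ 0 and F_ε(0) = 0, and let x : ℝ → ℝ² be twice continuously differentiable with velocity v = x′ satisfying v′(t) = F_ε(x(t)) for all t, x(0) = x⁻ := ε·(−√(1−b²), b), v(0) = v⁻ := (1,0). Suppose τ ∈ (0, 4ε] satisfies ‖x(τ)‖ = ε and ‖x(t)‖ ≤ ε for all t ∈ [0, τ], and that ‖v(t) − v⁻‖ ≤ K ε^α for all t ∈ [0, 4ε]. Then, with τ̂ := 2ε√(1−b²), ‖(v(τ) − v⁻) − ∫₀^{τ̂} F_ε(x(s)) ds‖ ≤ C ε^{3α}. -/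
open scoped RealInnerProductSpace

/-- A differentiable function that vanishes on `[1, ∞)` has zero derivative there. -/
theorem deriv_eq_zero_of_vanishing_Ici {V : ℝ → ℝ} (hV : Differentiable ℝ V)
    (hVsupp : ∀ r : ℝ, 1 ≤ r → V r = 0) {r : ℝ} (hr : 1 ≤ r) : deriv V r = 0 := by
  have hu : UniqueDiffWithinAt ℝ (Set.Ici r) r := uniqueDiffOn_Ici r r Set.self_mem_Ici
  have hd : HasDerivWithinAt V (deriv V r) (Set.Ici r) r := (hV r).hasDerivAt.hasDerivWithinAt
  have hz : HasDerivWithinAt V 0 (Set.Ici r) r :=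
    (hasDerivWithinAt_const r (Set.Ici r) (0 : ℝ)).congr
      (fun s hs => hVsupp s (hr.trans hs)) (hVsupp r hr)
  exact hu.eq_deriv _ hd hz

/-- The derivative of a `C²` function vanishing on `[1, ∞)` is `O(1 - r)` at the edge. -/
theorem exists_abs_deriv_le_mul_max {V : ℝ → ℝ} (hV : ContDiff ℝ 2 V)
    (hVsupp : ∀ r : ℝ, 1 ≤ r → V r = 0) :
    ∃ L > (0 : ℝ), ∀ r : ℝ, 0 ≤ r → |deriv V r| ≤ L * max 0 (1 - r) := by
  have hVd : Differentiable ℝ V := hV.differentiable (by norm_num)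
  have hV1 : ContDiff ℝ 1 (deriv V) := hV.deriv' (n := 1)
  obtain ⟨M, hM⟩ := (isCompact_Icc (a := (0 : ℝ)) (b := 1)).exists_bound_of_continuousOn
    (hV1.continuous_deriv le_rfl).continuousOn
  refine ⟨max M 1, by positivity, fun r hr => ?_⟩
  rcases le_total 1 r with h | h
  · rw [deriv_eq_zero_of_vanishing_Ici hVd hVsupp h, abs_zero]
    positivity
  · have key := (convex_Icc (0 : ℝ) 1).norm_image_sub_le_of_norm_hasDerivWithin_le
      (fun s _ => ((hV1.differentiable one_ne_zero) s).hasDerivAt.hasDerivWithinAt)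
      (fun s hs => (hM s hs).trans (le_max_left M 1))
      (Set.right_mem_Icc.2 zero_le_one) (Set.mem_Icc.2 ⟨hr, h⟩)
    rw [deriv_eq_zero_of_vanishing_Ici hVd hVsupp le_rfl, sub_zero, Real.norm_eq_abs,
      Real.norm_eq_abs, abs_sub_comm, abs_of_nonneg (sub_nonneg.2 h)] at key
    rwa [max_eq_right (sub_nonneg.2 h)]

/-- A central force is bounded in norm by its radial profile. -/
theorem norm_central_force_le {E : Type*} [NormedAddCommGroup E] [NormedSpace ℝ E]
    {F : E → E} {φ g : ℝ → ℝ}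
    (hF : ∀ y, y ≠ 0 → F y = -(φ ‖y‖ / ‖y‖) • y) (hF0 : F 0 = 0)
    (hg : ∀ r, 0 ≤ r → |φ r| ≤ g r) (y : E) : ‖F y‖ ≤ g ‖y‖ := by
  refine le_trans ?_ (hg _ (norm_nonneg y))
  rcases eq_or_ne y 0 with rfl | hy
  · simp [hF0]
  · rw [hF y hy, norm_smul, norm_neg, norm_div, norm_norm, Real.norm_eq_abs,
      div_mul_cancel₀ _ (norm_ne_zero_iff.2 hy)]

/-- If a motion ends on the sphere of radius `ε` at time `τ`, and is `κτ`-close to the straight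
line through the same starting point, then `τ` is close to the straight-line exit time `σ`. -/
theorem abs_exit_time_sub_le {E : Type*} [NormedAddCommGroup E] [InnerProductSpace ℝ E]
    {p q : E} {ε τ σ κ : ℝ} (hτ : 0 < τ) (hq : ‖q‖ = ε)
    (hp : ‖p‖ ^ 2 = ε ^ 2 + τ * (τ - σ)) (hpq : ‖q - p‖ ≤ κ * τ) :
    |τ - σ| ≤ 2 * ε * κ + κ ^ 2 * τ := by
  have hε : 0 ≤ ε := hq ▸ norm_nonneg q
  have hexp : ‖p‖ ^ 2 = ε ^ 2 - 2 * ⟪q, q - p⟫ + ‖q - p‖ ^ 2 := by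
    rw [← hq, ← norm_sub_sq_real, sub_sub_cancel]
  have hin : |⟪q, q - p⟫| ≤ ε * (κ * τ) :=
    (abs_real_inner_le_norm _ _).trans (by rw [hq]; gcongr)
  have hsq : ‖q - p‖ ^ 2 ≤ (κ * τ) ^ 2 := by gcongr
  have habs := abs_le.1 hin
  have hmul : τ * |τ - σ| ≤ τ * (2 * ε * κ + κ ^ 2 * τ) := by
    rw [← abs_of_pos hτ, ← abs_mul, abs_of_pos hτ, abs_le]
    constructor <;> nlinarith [sq_nonneg ‖q - p‖, sq_nonneg (κ * τ)]
  exact le_of_mul_le_mul_left hmul hτ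

theorem norm_vec2_sq (a b : ℝ) : ‖vec2 a b‖ ^ 2 = a ^ 2 + b ^ 2 := by
  simp [vec2, EuclideanSpace.norm_sq_eq, Fin.sum_univ_two]

/-- The squared distance from the centre along the straight line that enters the obstacle of
radius `ε` with impact parameter `εb`. -/
theorem norm_free_flight_sq {b : ℝ} (hb : b ∈ Set.Icc (-1 : ℝ) 1) (ε t : ℝ) :
    ‖ε • vec2 (-Real.sqrt (1 - b ^ 2)) b + t • vec2 1 0‖ ^ 2
      = ε ^ 2 + t * (t - 2 * ε * Real.sqrt (1 - b ^ 2)) := by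
  have hs : Real.sqrt (1 - b ^ 2) ^ 2 = 1 - b ^ 2 := Real.sq_sqrt (by nlinarith [hb.1, hb.2])
  have hv : ε • vec2 (-Real.sqrt (1 - b ^ 2)) b + t • vec2 1 0
      = vec2 (-ε * Real.sqrt (1 - b ^ 2) + t) (ε * b) := by
    ext i
    fin_cases i <;> simp [vec2]
  rw [hv, norm_vec2_sq]
  linear_combination ε ^ 2 * hs

/-- If the velocity stays `κ`-close to `u` on a convex set of times, then the displacement is
`κ`-Lipschitz close to uniform motion with velocity `u`. -/
theorem norm_displacement_sub_smul_le {E : Type*} [NormedAddCommGroup E] [NormedSpace ℝ E]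
    {x v : ℝ → E} {u : E} {κ : ℝ} {S : Set ℝ} (hS : Convex ℝ S)
    (hx : ∀ t, HasDerivAt x (v t) t) (hv : ∀ t ∈ S, ‖v t - u‖ ≤ κ)
    {s t : ℝ} (hs : s ∈ S) (ht : t ∈ S) :
    ‖x t - x s - (t - s) • u‖ ≤ κ * |t - s| := by
  have hd : ∀ r ∈ S, HasDerivWithinAt (fun r => x r - r • u) (v r - u) S r := fun r _ => by
    simpa using! ((hx r).sub ((hasDerivAt_id r).smul_const u)).hasDerivWithinAt (s := S)
  have key := hS.norm_image_sub_le_of_norm_hasDerivWithin_le hd hv hs ht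
  rw [Real.norm_eq_abs] at key
  convert key using 2
  rw [sub_smul]
  abel

/-- Fundamental theorem of calculus for a bounded derivative. -/
theorem integral_eq_sub_of_hasDerivAt_of_norm_le {E : Type*} [NormedAddCommGroup E]
    [NormedSpace ℝ E] [FiniteDimensional ℝ E] {f f' : ℝ → E} {M : ℝ}
    (hf : ∀ t, HasDerivAt f (f' t) t) (hM : ∀ t, ‖f' t‖ ≤ M) (a b : ℝ) :
    ∫ t in a..b, f' t = f b - f a := by
  have hfd : f' = deriv f := funext fun t => (hf t).deriv.symm
  have : CompleteSpace E := FiniteDimensional.complete ℝ E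
  have hmeas : MeasureTheory.StronglyMeasurable f' := by
    rw [hfd]
    exact stronglyMeasurable_deriv f
  refine intervalIntegral.integral_eq_sub_of_hasDerivAt (fun t _ => hf t) ?_
  exact (intervalIntegrable_const (c := M)).mono_fun hmeas.aestronglyMeasurable
    (Filter.Eventually.of_forall fun t => (hM t).trans (le_abs_self M))

/-- Across a single rescaled soft obstacle of radius `ε` with potential `ε^α V(‖·‖/ε)`
and impact parameter `εb`, the change in velocity equals the force integrated over the
straight-line exit time `τ̂ = 2ε√(1−b²)`, up to an error `O(ε^{3α})`. -/
theorem velocity_change_expansion (V : ℝ → ℝ) (hV : ContDiff ℝ 2 V)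
    (hVsupp : ∀ r : ℝ, 1 ≤ r → V r = 0) (hV'0 : deriv V 0 = 0)
    (α : ℝ) (hα : α ∈ Set.Ioc (0:ℝ) (1/2)) (K : ℝ) (hK : 0 < K) :
    ∃ C > (0:ℝ), ∃ ε₀ ∈ Set.Ioo (0:ℝ) 1,
      ∀ ε ∈ Set.Ioc (0:ℝ) ε₀, ∀ b ∈ Set.Icc (-1:ℝ) 1,
      ∀ F : EuclideanSpace ℝ (Fin 2) → EuclideanSpace ℝ (Fin 2),
        (∀ y, y ≠ 0 → F y = -((ε ^ (α - 1) * deriv V (‖y‖ / ε)) / ‖y‖) • y) → F 0 = 0 →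
      ∀ x v : ℝ → EuclideanSpace ℝ (Fin 2),
        (∀ t, HasDerivAt x (v t) t) →
        (∀ t, HasDerivAt v (F (x t)) t) →
        x 0 = ε • vec2 (-Real.sqrt (1 - b^2)) b →
        v 0 = vec2 1 0 →
      ∀ τ ∈ Set.Ioc (0:ℝ) (4 * ε),
        ‖x τ‖ = ε →
        (∀ t ∈ Set.Icc (0:ℝ) τ, ‖x t‖ ≤ ε) →
        (∀ t ∈ Set.Icc (0:ℝ) (4 * ε), ‖v t - vec2 1 0‖ ≤ K * ε ^ α) →
        ‖(v τ - vec2 1 0)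
            - ∫ s in (0:ℝ)..(2 * ε * Real.sqrt (1 - b^2)), F (x s)‖ ≤ C * ε ^ (3 * α) := by
  obtain ⟨L, hL, hVL⟩ := exists_abs_deriv_le_mul_max hV hVsupp
  set A : ℝ := 2 * K + 4 * K ^ 2 with hA
  have hA0 : 0 < A := by positivity
  refine ⟨L * (1 + K) * A ^ 2, by positivity, 1 / 2, by norm_num, ?_⟩
  intro ε hε b hb F hF hF0 x v hx hv hx0 hv0 τ hτ hxτ _ hvK
  have hε0 : 0 < ε := hε.1
  have hε1 : ε ≤ 1 := hε.2.trans (by norm_num)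
  set m : ℝ := ε ^ α with hm
  have hm0 : 0 < m := Real.rpow_pos_of_pos hε0 α
  have hm1 : m ≤ 1 := Real.rpow_le_one hε0.le hε1 hα.1.le
  have hpow : ε ^ (α - 1) = m / ε := by rw [Real.rpow_sub hε0, Real.rpow_one]
  have hcube : ε ^ (3 * α) = m ^ 3 := by
    rw [mul_comm, Real.rpow_mul hε0.le]
    exact_mod_cast Real.rpow_natCast (ε ^ α) 3
  have hforce : ∀ y, ‖F y‖ ≤ m / ε * (L * max 0 (1 - ‖y‖ / ε)) := by
    refine norm_central_force_le (φ := fun r => ε ^ (α - 1) * deriv V (r / ε))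
      (g := fun r => m / ε * (L * max 0 (1 - r / ε))) hF hF0 fun r hr => ?_
    rw [hpow, abs_mul, abs_of_pos (div_pos hm0 hε0)]
    gcongr
    exact hVL _ (by positivity)
  set σ : ℝ := 2 * ε * Real.sqrt (1 - b ^ 2) with hσ
  have hsqrt : Real.sqrt (1 - b ^ 2) ≤ 1 := Real.sqrt_le_one.2 (by nlinarith [sq_nonneg b])
  have hσmem : σ ∈ Set.Icc (0 : ℝ) (4 * ε) := ⟨by positivity, by nlinarith⟩
  have hτmem : τ ∈ Set.Icc (0 : ℝ) (4 * ε) := Set.Ioc_subset_Icc_self hτ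
  have h0mem : (0 : ℝ) ∈ Set.Icc (0 : ℝ) (4 * ε) := ⟨le_rfl, by positivity⟩
  have hdisp {s t : ℝ} (hs : s ∈ Set.Icc (0 : ℝ) (4 * ε)) (ht : t ∈ Set.Icc (0 : ℝ) (4 * ε)) :
      ‖x t - x s - (t - s) • vec2 1 0‖ ≤ K * m * |t - s| :=
    norm_displacement_sub_smul_le (convex_Icc _ _) hx hvK hs ht
  have hexit : |τ - σ| ≤ A * m * ε := by
    have hline : ‖x τ - (x 0 + τ • vec2 1 0)‖ ≤ K * m * τ := by
      simpa [sub_sub, abs_of_pos hτ.1] using hdisp h0mem hτmem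
    have h := abs_exit_time_sub_le hτ.1 hxτ
      (by rw [hx0]; exact norm_free_flight_sq hb ε τ) hline
    have h2 : (K * m) ^ 2 * τ ≤ K ^ 2 * m * (4 * ε) := by
      rw [mul_pow]
      gcongr
      · exact hτ.1.le
      · nlinarith
      · exact hτ.2
    rw [hA]
    linarith
  have hunit : ‖vec2 1 0‖ = 1 := by
    have h := norm_vec2_sq 1 0
    nlinarith [norm_nonneg (vec2 1 0)]
  have hFseg : ∀ s ∈ Set.uIcc σ τ, ‖F (x s)‖ ≤ m / ε * (L * ((1 + K) * A * m)) := by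
    intro s hs
    have hsmem : s ∈ Set.Icc (0 : ℝ) (4 * ε) := Set.ordConnected_Icc.uIcc_subset hσmem hτmem hs
    have hsτ : |τ - s| ≤ A * m * ε := (Set.abs_sub_right_of_mem_uIcc hs).trans hexit
    have hdist : ‖x τ - x s‖ ≤ (1 + K) * (A * m * ε) := by
      have htri : ‖x τ - x s‖ ≤ ‖x τ - x s - (τ - s) • vec2 1 0‖ + ‖(τ - s) • vec2 1 0‖ := by
        simpa using norm_add_le (x τ - x s - (τ - s) • vec2 1 0) ((τ - s) • vec2 1 0)
      rw [norm_smul, hunit, mul_one, Real.norm_eq_abs] at htri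
      have hKm : K * m * |τ - s| ≤ K * |τ - s| := by
        gcongr
        exact mul_le_of_le_one_right hK.le hm1
      calc ‖x τ - x s‖ ≤ (1 + K) * |τ - s| := by linarith [hdisp hsmem hτmem]
        _ ≤ (1 + K) * (A * m * ε) := by gcongr
    refine (hforce _).trans ?_
    gcongr
    refine max_le (by positivity) ?_
    rw [sub_le_comm, le_div_iff₀ hε0]
    have := norm_sub_norm_le (x τ) (x s)
    rw [hxτ] at this
    linarith
  have hFbdd : ∀ t, ‖F (x t)‖ ≤ m / ε * L := fun t => by
    refine (hforce _).trans ?_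
    gcongr
    refine mul_le_of_le_one_right hL.le (max_le zero_le_one ?_)
    have : 0 ≤ ‖x t‖ / ε := by positivity
    linarith
  rw [integral_eq_sub_of_hasDerivAt_of_norm_le hv hFbdd, hv0, sub_sub_sub_cancel_right, hcube]
  calc ‖v τ - v σ‖ ≤ m / ε * (L * ((1 + K) * A * m)) * |τ - σ| :=
        (convex_uIcc σ τ).norm_image_sub_le_of_norm_hasDerivWithin_le
          (fun s _ => (hv s).hasDerivWithinAt) hFseg Set.left_mem_uIcc Set.right_mem_uIcc
    _ ≤ m / ε * (L * ((1 + K) * A * m)) * (A * m * ε) := by gcongr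
    _ = L * (1 + K) * A ^ 2 * m ^ 3 := by field_simp
end

section
/- Let V : ℝ → ℝ be twice continuously differentiable with V(r) = 0 for r ≥ 1 and V′(0) = 0, let α ∈ (0, 1/2], and let K > 0. Then there exist constants C > 0 and ε₀ ∈ (0,1) depending only on V, α, K such that the following holds for every ε ∈ (0, ε₀] and b ∈ [−1, 1]. Define F_ε : ℝ² → ℝ² by F_ε(y) = −ε^{α−1} V′(‖y‖/ε) · y/‖y‖ for y ≠ 0 and F_ε(0) = 0, and let x : ℝ → ℝ² be twice continuously differentiable with velocity v = x′ satisfying v′(t) = F_ε(x(t)) for all t, x(0) = x⁻ := ε·(−√(1−b²), b), v(0) = v⁻ := (1,0). Suppose τ ∈ (0, 4ε] satisfies ‖x(τ)‖ = ε and ‖x(t)‖ ≤ ε for all t ∈ [0, τ], and that ‖v(t) − v⁻‖ ≤ K ε^α for all t ∈ [0, 4ε]. Then |⟨v(τ) − v⁻, v⁻⟩ + (1/2) ε^{2α} · (2 ∫_{|b|}^{1} V′(|b|/u) (b/u) du/√(1 − u²))²| ≤ C ε^{3α}. -/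
open scoped RealInnerProductSpace

open Set Filter Topology MeasureTheory

theorem norm_vec2 (p q : ℝ) : ‖vec2 p q‖ = Real.sqrt (p ^ 2 + q ^ 2) := by
  simp [vec2, EuclideanSpace.norm_eq, Fin.sum_univ_two]

theorem vec2_apply_zero (p q : ℝ) : vec2 p q 0 = p := by simp [vec2]

theorem vec2_apply_one (p q : ℝ) : vec2 p q 1 = q := by simp [vec2]

theorem inner_vec2_one_zero (w : EuclideanSpace ℝ (Fin 2)) : ⟪w, vec2 1 0⟫ = w 0 := by
  simp [vec2, PiLp.inner_apply, Fin.sum_univ_two]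

theorem deriv_eq_zero_of_one_le {V : ℝ → ℝ} (hV : ContDiff ℝ 2 V)
    (hVsupp : ∀ r : ℝ, 1 ≤ r → V r = 0) {r : ℝ} (hr : 1 ≤ r) : deriv V r = 0 := by
  have hcont : Continuous (deriv V) := hV.continuous_deriv (by norm_num)
  have hsub : Ioi (1:ℝ) ⊆ {r | deriv V r = 0} := fun s hs => by
    have : V =ᶠ[𝓝 s] fun _ => 0 := by
      filter_upwards [Ioi_mem_nhds hs] with t ht using hVsupp t (le_of_lt ht)
    simp [this.deriv_eq]
  have hcl : IsClosed {r | deriv V r = 0} := isClosed_eq hcont continuous_const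
  have := hcl.closure_subset_iff.2 hsub
  rw [closure_Ioi] at this
  exact this hr

theorem exists_lipschitz_deriv {V : ℝ → ℝ} (hV : ContDiff ℝ 2 V)
    (hVsupp : ∀ r : ℝ, 1 ≤ r → V r = 0) (hV'0 : deriv V 0 = 0) :
    ∃ L > (0:ℝ), (∀ r, 0 ≤ r → ∀ s, 0 ≤ s → |deriv V r - deriv V s| ≤ L * |r - s|) ∧
      ∀ r, 0 ≤ r → |deriv V r| ≤ L := by
  have h1 : ContDiff ℝ 1 (deriv V) := hV.deriv'
  obtain ⟨C, hC⟩ := (isCompact_Icc (a := (0:ℝ)) (b := 1)).exists_bound_of_continuousOn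
    (h1.continuous_deriv le_rfl).continuousOn
  have hL : 0 < |C| + 1 := by positivity
  have hlip : ∀ r ∈ Icc (0:ℝ) 1, ∀ s ∈ Icc (0:ℝ) 1,
      |deriv V r - deriv V s| ≤ (|C| + 1) * |r - s| := fun r hr s hs =>
    (convex_Icc (0:ℝ) 1).norm_image_sub_le_of_norm_deriv_le
      (fun x _ => (h1.differentiable (by norm_num)).differentiableAt)
      (fun x hx => (hC x hx).trans (by linarith [le_abs_self C])) hs hr
  have hmin : ∀ r, deriv V r = deriv V (min r 1) := fun r => by
    rcases le_total r 1 with h | h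
    · rw [min_eq_left h]
    · rw [min_eq_right h, deriv_eq_zero_of_one_le hV hVsupp h,
        deriv_eq_zero_of_one_le hV hVsupp le_rfl]
  have hmem : ∀ r, 0 ≤ r → min r 1 ∈ Icc (0:ℝ) 1 := fun r hr =>
    ⟨le_min hr zero_le_one, min_le_right _ _⟩
  refine ⟨|C| + 1, hL, fun r hr s hs => ?_, fun r hr => ?_⟩
  · rw [hmin r, hmin s]
    refine (hlip _ (hmem r hr) _ (hmem s hs)).trans ?_
    exact mul_le_mul_of_nonneg_left ((abs_min_sub_min_le_max r 1 s 1).trans (by simp)) hL.le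
  · have h := hlip _ (hmem r hr) 0 (by simp)
    rw [hV'0, ← hmin, sub_zero, sub_zero, abs_of_nonneg (hmem r hr).1] at h
    exact h.trans (mul_le_of_le_one_right hL.le (min_le_right _ _))

theorem norm_radial_sub_le {E : Type*} [NormedAddCommGroup E] [NormedSpace ℝ E] {W : ℝ → ℝ} {L : ℝ}
    (hlip : ∀ r, 0 ≤ r → ∀ s, 0 ≤ s → |W r - W s| ≤ L * |r - s|) (hW : W 0 = 0) (hL : 0 ≤ L)
    (y z : E) : ‖(W ‖y‖ / ‖y‖) • y - (W ‖z‖ / ‖z‖) • z‖ ≤ 3 * L * ‖y - z‖ := by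
  have hb : ∀ u : E, |W ‖u‖| ≤ L * ‖u‖ := fun u => by
    simpa [hW] using hlip ‖u‖ (norm_nonneg _) 0 le_rfl
  have hn : ∀ u : E, ‖(W ‖u‖ / ‖u‖) • u‖ ≤ L * ‖u‖ := fun u => by
    rw [norm_smul, norm_div, norm_norm]
    rcases eq_or_ne u 0 with rfl | hu
    · simp
    · rw [div_mul_cancel₀ _ (norm_ne_zero_iff.2 hu)]; exact hb u
  rcases eq_or_ne y 0 with rfl | hy
  · have := hn z
    have h2 : 0 ≤ L * ‖z‖ := by positivity
    simp only [smul_zero, zero_sub, norm_neg]; linarith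
  rcases eq_or_ne z 0 with rfl | hz
  · have := hn y
    have h2 : 0 ≤ L * ‖y‖ := by positivity
    simp only [smul_zero, sub_zero]; linarith
  have hy' : ‖y‖ ≠ 0 := norm_ne_zero_iff.2 hy
  have hz' : ‖z‖ ≠ 0 := norm_ne_zero_iff.2 hz
  have key : (W ‖y‖ / ‖y‖) • y - (W ‖z‖ / ‖z‖) • z
      = (W ‖y‖ / ‖y‖) • (y - z) + ((W ‖y‖ / ‖y‖) * ((‖z‖ - ‖y‖) / ‖z‖)) • z
        + ((W ‖y‖ - W ‖z‖) / ‖z‖) • z := by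
    match_scalars <;> field_simp
    ring
  have hq : |W ‖y‖| / ‖y‖ ≤ L := div_le_of_le_mul₀ (norm_nonneg _) hL (hb y)
  have habs : |‖z‖ - ‖y‖| ≤ ‖y - z‖ := by
    rw [abs_sub_comm]; exact abs_norm_sub_norm_le y z
  rw [key]
  have e1 : ‖(W ‖y‖ / ‖y‖) • (y - z)‖ ≤ L * ‖y - z‖ := by
    rw [norm_smul, norm_div, norm_norm]; gcongr; exact hq
  have e2 : ‖((W ‖y‖ / ‖y‖) * ((‖z‖ - ‖y‖) / ‖z‖)) • z‖ ≤ L * ‖y - z‖ := by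
    rw [norm_smul, norm_mul, norm_div, norm_norm, norm_div, norm_norm, mul_assoc,
      div_mul_cancel₀ _ hz']
    gcongr
    exacts [hq, habs]
  have e3 : ‖((W ‖y‖ - W ‖z‖) / ‖z‖) • z‖ ≤ L * ‖y - z‖ := by
    rw [norm_smul, norm_div, norm_norm, div_mul_cancel₀ _ hz']
    refine (hlip _ (norm_nonneg _) _ (norm_nonneg _)).trans ?_
    gcongr
    exact abs_norm_sub_norm_le y z
  calc _ ≤ _ := norm_add₃_le
    _ ≤ _ := by linarith

theorem hasDerivAt_div_sqrt {c s b : ℝ} (hb : b ≠ 0) :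
    HasDerivAt (fun s : ℝ => c / √(s ^ 2 + b ^ 2)) (-(c * s / √(s ^ 2 + b ^ 2) ^ 3)) s := by
  have hpos : 0 < s ^ 2 + b ^ 2 := by positivity
  have h1 : HasDerivAt (fun s : ℝ => s ^ 2 + b ^ 2) (2 * s) s := by
    simpa using ((hasDerivAt_pow 2 s).add_const (b ^ 2))
  have h3 := (hasDerivAt_const s c).div (h1.sqrt hpos.ne') (Real.sqrt_pos.2 hpos).ne'
  refine h3.congr_deriv ?_
  have := (Real.sqrt_pos.2 hpos).ne'
  field_simp
  ring

theorem integral_impact_eq {W : ℝ → ℝ} {b : ℝ} (hb : b ∈ Icc (-1:ℝ) 1) :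
    ∫ u in |b|..1, W (|b| / u) * (b / u) / √(1 - u ^ 2)
      = ∫ s in (0:ℝ)..√(1 - b ^ 2), W √(s ^ 2 + b ^ 2) / √(s ^ 2 + b ^ 2) * b := by
  rcases eq_or_ne b 0 with rfl | hb0
  · simp
  have hb1 : |b| ≤ 1 := abs_le.2 hb
  have hbp : 0 < |b| := abs_pos.2 hb0
  have hb2 : b ^ 2 ≤ 1 := by rw [← sq_abs]; nlinarith
  have hpos : ∀ s : ℝ, 0 < s ^ 2 + b ^ 2 := fun s => by positivity
  have hinj : StrictAntiOn (fun s : ℝ => |b| / √(s ^ 2 + b ^ 2)) (Ici 0) := fun s hs t _ hst => by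
    have : (0:ℝ) ≤ s := hs
    refine div_lt_div_of_pos_left hbp (Real.sqrt_pos.2 (hpos s)) ?_
    refine Real.sqrt_lt_sqrt (hpos s).le ?_
    gcongr
  have himg : (fun s : ℝ => |b| / √(s ^ 2 + b ^ 2)) '' Ioo 0 √(1 - b ^ 2) = Ioo |b| 1 := by
    ext u
    simp only [mem_image, mem_Ioo]
    constructor
    · rintro ⟨s, ⟨hs0, hs1⟩, rfl⟩
      have hs2 : s ^ 2 < 1 - b ^ 2 := by rwa [Real.lt_sqrt hs0.le] at hs1
      constructor
      · rw [lt_div_iff₀ (Real.sqrt_pos.2 (hpos s))]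
        refine mul_lt_of_lt_one_right hbp ?_
        rw [Real.sqrt_lt' one_pos]; linarith
      · rw [div_lt_one (Real.sqrt_pos.2 (hpos s))]
        refine Real.lt_sqrt_of_sq_lt ?_
        rw [sq_abs]; nlinarith
    · rintro ⟨hu0, hu1⟩
      have hu : 0 < u := hbp.trans hu0
      have h1 : 0 < (b / u) ^ 2 - b ^ 2 := by
        have : b ^ 2 < (b / u) ^ 2 := by
          rw [div_pow, lt_div_iff₀ (by positivity)]
          exact mul_lt_of_lt_one_right (by positivity) (by nlinarith)
        linarith
      refine ⟨√((b / u) ^ 2 - b ^ 2), ⟨Real.sqrt_pos.2 h1, Real.sqrt_lt_sqrt h1.le ?_⟩, ?_⟩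
      · have : (b / u) ^ 2 < 1 := by
          rw [div_pow, div_lt_one (by positivity), ← sq_abs b]
          gcongr
        linarith
      · rw [Real.sq_sqrt h1.le, sub_add_cancel, Real.sqrt_sq_eq_abs, abs_div, abs_of_pos hu]
        field_simp
  rw [intervalIntegral.integral_of_le hb1, intervalIntegral.integral_of_le (Real.sqrt_nonneg _),
    integral_Ioc_eq_integral_Ioo, integral_Ioc_eq_integral_Ioo, ← himg,
    integral_image_eq_integral_abs_deriv_smul measurableSet_Ioo
      (fun s _ => (hasDerivAt_div_sqrt hb0).hasDerivWithinAt)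
      (hinj.injOn.mono fun s hs => hs.1.le)]
  refine setIntegral_congr_fun measurableSet_Ioo fun s hs => ?_
  have hs0 : 0 < s := hs.1
  have hr := Real.sqrt_pos.2 (hpos s)
  have hrsq := Real.sq_sqrt (hpos s).le
  set r := √(s ^ 2 + b ^ 2)
  have h1 : |-(|b| * s / r ^ 3)| = |b| * s / r ^ 3 := by
    rw [abs_neg, abs_of_pos (by positivity)]
  have h2 : √(1 - (|b| / r) ^ 2) = s / r := by
    rw [show 1 - (|b| / r) ^ 2 = (s / r) ^ 2 by
      rw [div_pow, div_pow, sq_abs]; field_simp; linarith]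
    exact Real.sqrt_sq (by positivity)
  have h3 : |b| / (|b| / r) = r := by field_simp
  rw [h1, h2, h3, smul_eq_mul]
  field_simp

theorem integral_chord_eq {f : ℝ → ℝ} (hf : Continuous f) (heven : ∀ s, f (-s) = f s) (a : ℝ) :
    ∫ s in (0:ℝ)..(2 * a), f (s - a) = 2 * ∫ s in (0:ℝ)..a, f s := by
  rw [intervalIntegral.integral_comp_sub_right f a, zero_sub, two_mul, add_sub_cancel_right,
    ← intervalIntegral.integral_add_adjacent_intervals (b := 0) (hf.intervalIntegrable _ _)
      (hf.intervalIntegrable _ _), two_mul]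
  congr 1
  have := intervalIntegral.integral_comp_neg (a := 0) (b := a) f
  simp only [heven, neg_zero] at this
  exact this.symm

theorem norm_velocity_eq {E : Type*} [NormedAddCommGroup E] [InnerProductSpace ℝ E]
    {V : ℝ → ℝ} (hV : Differentiable ℝ V) (hV'0 : deriv V 0 = 0)
    {c ε : ℝ} {x v : ℝ → E} (hx : ∀ t, HasDerivAt x (v t) t)
    (hv : ∀ t, HasDerivAt v (-(c / ε * deriv V (‖x t‖ / ε) / ‖x t‖) • x t) t)
    {s t : ℝ} (hst : ‖x s‖ = ‖x t‖) : ‖v s‖ ^ 2 = ‖v t‖ ^ 2 := by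
  have hpot : ∀ t, HasDerivAt (fun t => V (‖x t‖ / ε))
      (deriv V (‖x t‖ / ε) * (⟪x t, v t⟫ / ‖x t‖ / ε)) t := fun t => by
    rcases eq_or_ne (x t) 0 with h0 | h0
    · have hV0 : HasDerivAt V 0 (‖x t‖ / ε) := by
        simpa [h0, hV'0] using (hV 0).hasDerivAt
      have hlit := hV0.isLittleO
      simp only [h0, norm_zero, zero_div, sub_zero, smul_zero] at hlit
      have htend : Tendsto (fun u => ‖x u‖ / ε) (𝓝 t) (𝓝 0) := by
        have := ((hx t).continuousAt.norm.div_const ε).tendsto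
        simpa [h0] using this
      have h2 := hlit.comp_tendsto htend
      have h3 : (fun u => ‖x u‖ / ε) =O[𝓝 t] fun u => u - t := by
        have := (hx t).isBigO_sub
        rw [h0] at this
        simp only [sub_zero] at this
        simpa [div_eq_inv_mul] using this.norm_left.const_mul_left ε⁻¹
      have h4 := h2.trans_isBigO h3
      rw [hasDerivAt_iff_isLittleO]
      simpa [h0, Function.comp_def] using h4
    · have hsq := (hx t).norm_sq
      have hpos : ‖x t‖ ^ 2 ≠ 0 := by simpa using h0
      have hn : HasDerivAt (fun t => ‖x t‖) (⟪x t, v t⟫ / ‖x t‖) t := by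
        have := hsq.sqrt hpos
        simp only [Real.sqrt_sq (norm_nonneg _)] at this
        convert this using 1
        rw [mul_div_mul_left _ _ two_ne_zero]
      exact (hV _).hasDerivAt.comp t (hn.div_const ε)
  have hE : ∀ t, HasDerivAt (fun t => ‖v t‖ ^ 2 + 2 * c * V (‖x t‖ / ε)) 0 t := fun t => by
    refine ((hv t).norm_sq.add ((hpot t).const_mul (2 * c))).congr_deriv ?_
    rw [inner_smul_right, real_inner_comm (v t)]
    ring
  have := is_const_of_deriv_eq_zero (fun t => (hE t).differentiableAt) (fun t => (hE t).deriv) s t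
  rw [hst] at this
  linarith

theorem abs_chord_sub_le {E : Type*} [NormedAddCommGroup E] [InnerProductSpace ℝ E]
    {p q e : E} {ρ τ δ : ℝ} (hρ : 0 < ρ) (hτ : 0 < τ) (hτ4 : τ ≤ 4 * ρ) (he : ‖e‖ = 1)
    (hp : ‖p‖ = ρ) (hq : ‖q‖ = ρ) (hδ : ‖q - (p + τ • e)‖ ≤ δ * τ) :
    |τ + 2 * ⟪p, e⟫| ≤ 6 * ρ * δ := by
  have hexp : ‖p + τ • e‖ ^ 2 = ρ ^ 2 + τ * (τ + 2 * ⟪p, e⟫) := by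
    rw [norm_add_sq_real, norm_smul, he, hp, inner_smul_right, Real.norm_of_nonneg hτ.le]
    ring
  have hn : ‖p + τ • e‖ ≤ 5 * ρ := by
    refine (norm_add_le _ _).trans ?_
    rw [norm_smul, he, hp, Real.norm_of_nonneg hτ.le]
    linarith
  have hd : |‖p + τ • e‖ - ρ| ≤ δ * τ := by
    rw [← hq, abs_sub_comm]
    exact (abs_norm_sub_norm_le _ _).trans hδ
  have hmul : τ * |τ + 2 * ⟪p, e⟫| = |‖p + τ • e‖ - ρ| * (‖p + τ • e‖ + ρ) := by
    nth_rewrite 1 [← abs_of_pos hτ]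
    rw [← abs_mul, show τ * (τ + 2 * ⟪p, e⟫) = (‖p + τ • e‖ - ρ) * (‖p + τ • e‖ + ρ) by
      linear_combination -hexp, abs_mul, abs_of_nonneg (a := ‖p + τ • e‖ + ρ) (by positivity)]
  refine le_of_mul_le_mul_left ?_ hτ
  calc τ * |τ + 2 * ⟪p, e⟫| = |‖p + τ • e‖ - ρ| * (‖p + τ • e‖ + ρ) := hmul
    _ ≤ (δ * τ) * (6 * ρ) :=
      mul_le_mul hd (by linarith) (by positivity) ((abs_nonneg _).trans hd)
    _ = τ * (6 * ρ * δ) := by ring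

theorem abs_deflection_le {w₀ w₁ e I K M : ℝ} (he : 0 < e) (he1 : e ≤ 1) (hK : 0 ≤ K)
    (hM : 0 ≤ M) (hw₀ : w₀ = -(w₀ ^ 2 + w₁ ^ 2) / 2) (hw : w₀ ^ 2 + w₁ ^ 2 ≤ (K * e) ^ 2)
    (h : |w₁ + 2 * I * e| ≤ M * e ^ 2) :
    |w₀ + 1 / 2 * e ^ 2 * (2 * I) ^ 2| ≤ (M * (2 * K + M) + K ^ 4) * e ^ 3 := by
  have h1 : |w₁| ≤ K * e := abs_le_of_sq_le_sq (by nlinarith) (by positivity)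
  have h0 : w₀ ^ 2 ≤ (K * e) ^ 4 := by
    rw [hw₀]
    have := sq_nonneg w₀
    have := sq_nonneg w₁
    nlinarith [mul_self_le_mul_self (by positivity) hw]
  have he2 : e ^ 2 ≤ e := by nlinarith
  have h2 : |2 * I * e - w₁| ≤ 2 * K * e + M * e := by
    have h3 : 2 * I * e - w₁ = (w₁ + 2 * I * e) - 2 * w₁ := by ring
    rw [h3]
    refine (abs_sub _ _).trans ?_
    rw [abs_mul, abs_two]
    nlinarith
  have h4 : |(w₁ + 2 * I * e) * (2 * I * e - w₁)| ≤ (M * e ^ 2) * (2 * K * e + M * e) := by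
    rw [abs_mul]
    exact mul_le_mul h h2 (abs_nonneg _) (by positivity)
  have h5 : w₀ + 1 / 2 * e ^ 2 * (2 * I) ^ 2
      = 1 / 2 * ((w₁ + 2 * I * e) * (2 * I * e - w₁)) - 1 / 2 * w₀ ^ 2 := by
    linear_combination hw₀
  have h6 : (K * e) ^ 4 ≤ K ^ 4 * e ^ 3 := by
    rw [mul_pow]
    exact mul_le_mul_of_nonneg_left (pow_le_pow_of_le_one he.le he1 (by norm_num)) (by positivity)
  have h7 : 0 ≤ M * (2 * K + M) * e ^ 3 := by positivity
  have h8 : 0 ≤ K ^ 4 * e ^ 3 := by positivity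
  rw [h5, abs_le]
  obtain ⟨ha, hb⟩ := abs_le.1 h4
  have := sq_nonneg w₀
  constructor <;> nlinarith

theorem transverse_velocity_le {W : ℝ → ℝ} {L : ℝ} (hL : 0 ≤ L)
    (hlip : ∀ r, 0 ≤ r → ∀ s, 0 ≤ s → |W r - W s| ≤ L * |r - s|)
    (hbd : ∀ r, 0 ≤ r → |W r| ≤ L) (hW : W 0 = 0) {e ε K a b τ : ℝ} (he : 0 ≤ e) (hε : 0 < ε)
    (hτ : τ ∈ Ioc 0 (4 * ε)) (ha : |τ - 2 * (ε * a)| ≤ 6 * ε * (K * e)) (hK : 0 ≤ K)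
    {x v : ℝ → EuclideanSpace ℝ (Fin 2)}
    (hv : ∀ t, HasDerivAt v (-(e / ε * W (‖x t‖ / ε) / ‖x t‖) • x t) t)
    (hx : ∀ t ∈ Icc (0:ℝ) τ, ‖x t - (ε • vec2 (-a) b + t • vec2 1 0)‖ ≤ K * e * t)
    (hv0 : v 0 = vec2 1 0) :
    |v τ 1 + 2 * (∫ s in (0:ℝ)..a, W √(s ^ 2 + b ^ 2) / √(s ^ 2 + b ^ 2) * b) * e|
      ≤ 54 * L * K * e ^ 2 := by
  set g : EuclideanSpace ℝ (Fin 2) → EuclideanSpace ℝ (Fin 2) :=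
    fun y => (W ‖y‖ / ‖y‖) • y with hg
  have hglip : ∀ y z, ‖g y - g z‖ ≤ 3 * L * ‖y - z‖ := norm_radial_sub_le hlip hW hL
  set f : ℝ → ℝ := fun s => W √(s ^ 2 + b ^ 2) / √(s ^ 2 + b ^ 2) * b with hf
  have hfg : ∀ s, f s = g (vec2 s b) 1 := fun s => by
    simp [hg, hf, norm_vec2, vec2_apply_one]
  have hcoord : ∀ (y : EuclideanSpace ℝ (Fin 2)) i, |y i| ≤ ‖y‖ := fun y i =>
    PiLp.norm_apply_le y i
  have hflip : ∀ s t, |f s - f t| ≤ 3 * L * |s - t| := fun s t => by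
    rw [hfg, hfg]
    refine ((hcoord (g (vec2 s b) - g (vec2 t b)) 1).trans (hglip _ _)).trans_eq ?_
    have : vec2 s b - vec2 t b = vec2 (s - t) 0 := by
      ext i; fin_cases i <;> simp [vec2]
    rw [this, norm_vec2]
    simp [Real.sqrt_sq_eq_abs]
  have hfcont : Continuous f := by
    refine (LipschitzWith.of_dist_le_mul (K := ⟨3 * L, by positivity⟩) fun s t => ?_).continuous
    exact hflip s t
  have hfbd : ∀ s, |f s| ≤ L := fun s => by
    rw [hfg]
    refine (hcoord _ 1).trans ?_
    rw [hg, norm_smul, norm_div, norm_norm]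
    rw [div_mul_comm]
    exact (mul_le_of_le_one_left (norm_nonneg _) (div_self_le_one _)).trans (hbd _ (norm_nonneg _))
  have hfe : ∀ s, f (-s) = f s := fun s => by simp [hf]
  have hfc : Continuous fun s => f (s - a) := by fun_prop
  set H : ℝ → ℝ := fun r => ∫ s in (0:ℝ)..r, f (s - a) with hH
  have hHd : ∀ r, HasDerivAt H (f (r - a)) r := fun r =>
    intervalIntegral.integral_hasDerivAt_right (hfc.intervalIntegrable _ _)
      (hfc.stronglyMeasurableAtFilter _ _) hfc.continuousAt
  have hH0 : H 0 = 0 := by simp [hH]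
  have hHa : H (2 * a) = 2 * ∫ s in (0:ℝ)..a, f s := integral_chord_eq hfcont hfe a
  have hHlip : |H (τ / ε) - H (2 * a)| ≤ L * |τ / ε - 2 * a| :=
    convex_univ.norm_image_sub_le_of_norm_hasDerivWithin_le
      (fun r _ => (hHd r).hasDerivWithinAt) (fun r _ => hfbd _) (mem_univ _) (mem_univ _)
  have hτa : |τ / ε - 2 * a| ≤ 6 * (K * e) := by
    have : τ / ε - 2 * a = (τ - 2 * (ε * a)) / ε := by field_simp
    rw [this, abs_div, abs_of_pos hε, div_le_iff₀ hε]
    linarith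
  have hforce : ∀ y : EuclideanSpace ℝ (Fin 2),
      -(e / ε * W (‖y‖ / ε) / ‖y‖) • y = -(e / ε) • g (ε⁻¹ • y) := fun y => by
    simp only [hg, norm_smul, norm_inv, Real.norm_of_nonneg hε.le, smul_smul]
    congr 1
    rw [inv_mul_eq_div]
    field_simp
  have hv1 : ∀ t, HasDerivAt (fun t => v t 1) (-(e / ε) * g (ε⁻¹ • x t) 1) t := fun t => by
    have h := (EuclideanSpace.proj (𝕜 := ℝ) (1 : Fin 2)).hasFDerivAt.comp_hasDerivAt t (hv t)
    rw [hforce] at h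
    simpa [Function.comp_def] using h
  have hD : ∀ t, HasDerivAt (fun t => v t 1 + e * H (t / ε))
      (-(e / ε) * g (ε⁻¹ • x t) 1 + e * (f (t / ε - a) * (1 / ε))) t := fun t => by
    have h : HasDerivAt (fun t => H (t / ε)) (f (t / ε - a) * (1 / ε)) t :=
      HasDerivAt.comp (h := fun t => t / ε) t (hHd (t / ε)) ((hasDerivAt_id t).div_const ε)
    exact (hv1 t).add (h.const_mul e)
  have hDle : ∀ t ∈ Ico (0:ℝ) τ,
      ‖-(e / ε) * g (ε⁻¹ • x t) 1 + e * (f (t / ε - a) * (1 / ε))‖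
        ≤ e / ε * (12 * L * K * e) := fun t ht => by
    have hsplit : -(e / ε) * g (ε⁻¹ • x t) 1 + e * (f (t / ε - a) * (1 / ε))
        = -(e / ε) * (g (ε⁻¹ • x t) - g (vec2 (t / ε - a) b)) 1 := by
      rw [hfg, PiLp.sub_apply]; ring
    have hpos : ε⁻¹ • x t - vec2 (t / ε - a) b
        = ε⁻¹ • (x t - (ε • vec2 (-a) b + t • vec2 1 0)) := by
      ext i; fin_cases i
      · simp [vec2]; field_simp; ring
      · simp [vec2]; field_simp
    rw [hsplit, norm_mul, norm_neg, Real.norm_of_nonneg (by positivity : 0 ≤ e / ε)]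
    refine mul_le_mul_of_nonneg_left ?_ (by positivity)
    refine ((hcoord _ 1).trans (hglip _ _)).trans ?_
    rw [hpos, norm_smul, norm_inv, Real.norm_of_nonneg hε.le]
    calc 3 * L * (ε⁻¹ * ‖x t - (ε • vec2 (-a) b + t • vec2 1 0)‖)
        ≤ 3 * L * (ε⁻¹ * (K * e * (4 * ε))) := by
          gcongr
          refine (hx t ⟨ht.1, ht.2.le⟩).trans ?_
          gcongr
          exact ht.2.le.trans hτ.2
      _ = 12 * L * K * e := by field_simp; ring
  have hmain := norm_image_sub_le_of_norm_deriv_le_segment'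
    (fun t _ => (hD t).hasDerivWithinAt) hDle τ ⟨hτ.1.le, le_rfl⟩
  have h1 : |v τ 1 + e * H (τ / ε)| ≤ 48 * L * K * e ^ 2 := by
    simp only [hv0, vec2_apply_one, zero_div, hH0, mul_zero, add_zero, sub_zero] at hmain
    refine hmain.trans ?_
    calc e / ε * (12 * L * K * e) * τ ≤ e / ε * (12 * L * K * e) * (4 * ε) := by
          gcongr
          exact hτ.2
      _ = 48 * L * K * e ^ 2 := by field_simp; ring
  have h2 : |e * (H (2 * a) - H (τ / ε))| ≤ 6 * L * K * e ^ 2 := by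
    rw [abs_mul, abs_of_nonneg he, abs_sub_comm]
    calc e * |H (τ / ε) - H (2 * a)| ≤ e * (L * (6 * (K * e))) := by
          gcongr
          exact hHlip.trans (mul_le_mul_of_nonneg_left hτa hL)
      _ = _ := by ring
  rw [← hHa, show v τ 1 + H (2 * a) * e = (v τ 1 + e * H (τ / ε)) + e * (H (2 * a) - H (τ / ε))
    by ring]
  refine (abs_add_le _ _).trans ?_
  linarith

/-- Deflection-angle expansion: the squared deflection angle of a unit-speed particle
scattering off a single rescaled soft obstacle of radius `ε`, potential `ε^α V(‖·‖/ε)`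
and impact parameter `εb` equals `ε^{2α} (2∫_{|b|}^1 V′(|b|/u)(b/u) du/√(1−u²))²` up to
an error `O(ε^{3α})`, formulated via `⟨v⁺ − v⁻, v⁻⟩ = cos θ − 1 ≈ −θ²/2`. -/
theorem deflection_angle_expansion (V : ℝ → ℝ) (hV : ContDiff ℝ 2 V)
    (hVsupp : ∀ r : ℝ, 1 ≤ r → V r = 0) (hV'0 : deriv V 0 = 0)
    (α : ℝ) (hα : α ∈ Set.Ioc (0:ℝ) (1/2)) (K : ℝ) (hK : 0 < K) :
    ∃ C > (0:ℝ), ∃ ε₀ ∈ Set.Ioo (0:ℝ) 1,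
      ∀ ε ∈ Set.Ioc (0:ℝ) ε₀, ∀ b ∈ Set.Icc (-1:ℝ) 1,
      ∀ F : EuclideanSpace ℝ (Fin 2) → EuclideanSpace ℝ (Fin 2),
        (∀ y, y ≠ 0 → F y = -((ε ^ (α - 1) * deriv V (‖y‖ / ε)) / ‖y‖) • y) → F 0 = 0 →
      ∀ x v : ℝ → EuclideanSpace ℝ (Fin 2),
        (∀ t, HasDerivAt x (v t) t) →
        (∀ t, HasDerivAt v (F (x t)) t) →
        x 0 = ε • vec2 (-Real.sqrt (1 - b^2)) b →
        v 0 = vec2 1 0 →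
      ∀ τ ∈ Set.Ioc (0:ℝ) (4 * ε),
        ‖x τ‖ = ε →
        (∀ t ∈ Set.Icc (0:ℝ) τ, ‖x t‖ ≤ ε) →
        (∀ t ∈ Set.Icc (0:ℝ) (4 * ε), ‖v t - vec2 1 0‖ ≤ K * ε ^ α) →
        |⟪v τ - vec2 1 0, vec2 1 0⟫
            + (1/2 : ℝ) * ε ^ (2 * α) *
              (2 * ∫ u in |b|..1, deriv V (|b| / u) * (b / u) / Real.sqrt (1 - u^2))^2|
          ≤ C * ε ^ (3 * α) := by
  obtain ⟨L, hL, hlip, hbd⟩ := exists_lipschitz_deriv hV hVsupp hV'0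
  have hM : 0 ≤ 54 * L * K := by positivity
  refine ⟨54 * L * K * (2 * K + 54 * L * K) + K ^ 4, by positivity, 1 / 2, by norm_num, ?_⟩
  intro ε hε b hb F hF hF0 x v hx hv hx0 hv0 τ hτ hxτ _ hvK
  have hε0 : 0 < ε := hε.1
  have hε1 : ε ≤ 1 := hε.2.trans (by norm_num)
  set e := ε ^ α with he
  have he0 : 0 < e := Real.rpow_pos_of_pos hε0 α
  have he1 : e ≤ 1 := Real.rpow_le_one hε0.le hε1 hα.1.le
  have hpow2 : ε ^ (2 * α) = e ^ 2 := by
    rw [mul_comm, Real.rpow_mul hε0.le, Real.rpow_two]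
  have hpow3 : ε ^ (3 * α) = e ^ 3 := by
    rw [mul_comm, Real.rpow_mul hε0.le]; exact_mod_cast Real.rpow_natCast _ 3
  have hpow1 : ε ^ (α - 1) = e / ε := by rw [Real.rpow_sub hε0, Real.rpow_one]
  have hv' : ∀ t, HasDerivAt v (-(e / ε * deriv V (‖x t‖ / ε) / ‖x t‖) • x t) t := fun t => by
    rcases eq_or_ne (x t) 0 with h | h
    · simpa [h, hF0] using hv t
    · simpa only [hF _ h, hpow1] using hv t
  have hb2 : 0 ≤ 1 - b ^ 2 := by nlinarith [hb.1, hb.2]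
  set a := √(1 - b ^ 2) with ha
  have hx0n : ‖x 0‖ = ε := by
    rw [hx0, norm_smul, norm_vec2, neg_sq, Real.sq_sqrt hb2, sub_add_cancel, Real.sqrt_one,
      mul_one, Real.norm_of_nonneg hε0.le]
  have hvn : ‖v τ‖ ^ 2 = 1 := by
    rw [norm_velocity_eq (hV.differentiable (by norm_num)) hV'0 hx hv' (hxτ.trans hx0n.symm), hv0,
      norm_vec2]
    simp
  have hxlin : ∀ t ∈ Icc (0:ℝ) τ, ‖x t - (ε • vec2 (-a) b + t • vec2 1 0)‖ ≤ K * e * t := by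
    intro t ht
    have hd : ∀ s, HasDerivAt (fun s => x s - s • vec2 1 0) (v s - vec2 1 0) s := fun s => by
      have h := (hx s).sub ((hasDerivAt_id s).smul_const (vec2 1 0))
      rw [one_smul] at h
      exact h
    have h := norm_image_sub_le_of_norm_deriv_le_segment' (fun s _ => (hd s).hasDerivWithinAt)
      (fun s hs => hvK s ⟨hs.1, hs.2.le.trans hτ.2⟩) t ht
    simp only [zero_smul, sub_zero, hx0] at h
    rw [sub_add_eq_sub_sub, sub_right_comm]
    exact h
  have hchord : |τ - 2 * (ε * a)| ≤ 6 * ε * (K * e) := by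
    have h := abs_chord_sub_le hε0 hτ.1 hτ.2 (by simp [norm_vec2]) (hx0 ▸ hx0n) hxτ
      (hxlin τ ⟨hτ.1.le, le_rfl⟩)
    rw [inner_vec2_one_zero] at h
    simp only [PiLp.smul_apply, vec2_apply_zero, smul_eq_mul] at h
    convert h using 2
    ring
  have hw₁ := transverse_velocity_le hL.le hlip hbd hV'0 he0.le hε0 hτ hchord hK.le hv' hxlin hv0
    (b := b)
  have hwK := hvK τ ⟨hτ.1.le, hτ.2⟩
  have hw : (v τ 0 - 1) ^ 2 + v τ 1 ^ 2 ≤ (K * e) ^ 2 := by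
    have h := pow_le_pow_left₀ (norm_nonneg _) hwK 2
    rw [EuclideanSpace.norm_sq_eq, Fin.sum_univ_two] at h
    simpa [vec2_apply_zero, vec2_apply_one] using h
  rw [EuclideanSpace.norm_sq_eq, Fin.sum_univ_two, Real.norm_eq_abs, Real.norm_eq_abs, sq_abs,
    sq_abs] at hvn
  rw [inner_vec2_one_zero, PiLp.sub_apply, vec2_apply_zero, integral_impact_eq hb, hpow2, hpow3]
  exact abs_deflection_le he0 he1 hK.le hM (by linear_combination hvn / 2) hw hw₁
end

section
/- Let W : ℝ² → ℝ be continuously differentiable with compact support, and let ∂₂W denote its partial derivative in the second coordinate. Let 𝓕W denote the Fourier transform of W on ℝ² with the convention 𝓕W(ξ) = ∫_{ℝ²} W(x) e^{−2πi⟨x,ξ⟩} dx. Then ∫_ℝ (∫_ℝ ∂₂W(ξ, b) dξ)² db = 4π² ∫_ℝ k² ‖𝓕W((0, k))‖² dk. -/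
open scoped FourierTransform RealInnerProductSpace

open MeasureTheory

section Plancherel

variable {V F : Type*} [NormedAddCommGroup V] [InnerProductSpace ℝ V] [FiniteDimensional ℝ V]
  [MeasurableSpace V] [BorelSpace V] [NormedAddCommGroup F] [InnerProductSpace ℂ F]

lemma MeasureTheory.L2.norm_sq_eq_integral_norm_sq {α : Type*} {m : MeasurableSpace α}
    {μ : Measure α} (f : Lp F 2 μ) : ‖f‖ ^ 2 = ∫ x, ‖f x‖ ^ 2 ∂μ := by
  have h := L2.inner_def (𝕜 := ℂ) f f
  simp only [inner_self_eq_norm_sq_to_K] at h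
  norm_cast at h

variable [CompleteSpace F]

/-- On `L¹ ∩ L²`, the `L²` Fourier transform is given by the Fourier integral. -/
lemma MeasureTheory.MemLp.fourier_toLp_ae_eq {f : V → F} (hf : Integrable f) (hf2 : MemLp f 2) :
    (𝓕 (hf2.toLp f) : Lp F 2 (volume : Measure V)) =ᵐ[volume] 𝓕 f := by
  have hcont : Continuous (𝓕 f) := VectorFourier.fourierIntegral_continuous
    Real.continuous_fourierChar (innerSL ℝ).continuous₂ hf
  refine ae_eq_of_integral_contDiff_smul_eq
    ((Lp.memLp _).locallyIntegrable one_le_two) hcont.locallyIntegrable fun g hg hgc => ?_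
  let G : SchwartzMap V ℂ := HasCompactSupport.toSchwartzMap
    (f := Complex.ofRealCLM ∘ g) (hgc.comp_left rfl) (by fun_prop)
  have hG (x : V) : G x = (g x : ℂ) := rfl
  have key := congrArg (fun T => T G) (Lp.fourier_toTemperedDistribution_eq (hf2.toLp f))
  simp only [TemperedDistribution.fourier_apply, Lp.toTemperedDistribution_apply] at key
  have h1 : ∫ x, (𝓕 G) x • hf2.toLp f x = ∫ x, 𝓕 (G : V → ℂ) x • f x := by
    refine integral_congr_ae ?_
    filter_upwards [hf2.coeFn_toLp] with x hx
    rw [hx, SchwartzMap.fourier_coe]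
  have h2 : ∫ x, 𝓕 (G : V → ℂ) x • f x = ∫ x, G x • 𝓕 f x := by
    simpa using! VectorFourier.integral_fourierIntegral_smul_eq_flip (L := innerₗ V)
      Real.continuous_fourierChar continuous_inner G.integrable hf
  have h3 := key.symm.trans (h1.trans h2)
  simpa only [hG, Complex.coe_smul] using h3

/-- Plancherel's theorem for the Fourier integral of a function in `L¹ ∩ L²`. -/
theorem integral_norm_sq_fourier_eq {f : V → F} (hf : Integrable f) (hf2 : MemLp f 2) :
    ∫ w, ‖𝓕 f w‖ ^ 2 = ∫ v, ‖f v‖ ^ 2 := by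
  have h := congrArg (· ^ 2) (Lp.norm_fourier_eq (hf2.toLp f))
  simp only [L2.norm_sq_eq_integral_norm_sq] at h
  calc
    _ = ∫ w, ‖(𝓕 (hf2.toLp f) : Lp F 2 (volume : Measure V)) w‖ ^ 2 := by
      refine integral_congr_ae ?_
      filter_upwards [MemLp.fourier_toLp_ae_eq hf hf2] with x hx
      rw [hx]
    _ = ∫ v, ‖hf2.toLp f v‖ ^ 2 := h
    _ = _ := by
      refine integral_congr_ae ?_
      filter_upwards [hf2.coeFn_toLp] with x hx
      rw [hx]

end Plancherel

section FourierSlice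

lemma continuous_vec2 : Continuous fun p : ℝ × ℝ => vec2 p.1 p.2 := by
  unfold vec2
  fun_prop

lemma measurePreserving_vec2 : MeasurePreserving fun p : ℝ × ℝ => vec2 p.1 p.2 :=
  (PiLp.volume_preserving_toLp (Fin 2)).comp (volume_preserving_finTwoArrow ℝ).symm

lemma measurableEmbedding_vec2 : MeasurableEmbedding fun p : ℝ × ℝ => vec2 p.1 p.2 :=
  (MeasurableEquiv.toLp 2 (Fin 2 → ℝ)).measurableEmbedding.comp
    (MeasurableEquiv.finTwoArrow (α := ℝ)).symm.measurableEmbedding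

lemma inner_vec2 (a b c d : ℝ) : ⟪vec2 a b, vec2 c d⟫ = a * c + b * d := by
  simp [vec2, PiLp.inner_apply, mul_comm]

variable {E : Type*} [NormedAddCommGroup E] [NormedSpace ℂ E]

/-- Fourier slice theorem for horizontal lines in the plane. -/
theorem fourier_integral_vec2 {f : EuclideanSpace ℝ (Fin 2) → E} (hf : Integrable f) (k : ℝ) :
    𝓕 (fun b : ℝ => ∫ ξ : ℝ, f (vec2 ξ b)) k = 𝓕 f (vec2 0 k) := by
  have hint : Integrable fun p : ℝ × ℝ =>
      Real.fourierChar (-⟪vec2 p.1 p.2, vec2 0 k⟫) • f (vec2 p.1 p.2) :=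
    (measurePreserving_vec2.integrable_comp_emb measurableEmbedding_vec2).2
      ((Real.fourierIntegral_convergent_iff (vec2 0 k)).2 hf)
  rw [Real.fourier_eq, Real.fourier_eq,
    ← measurePreserving_vec2.integral_comp measurableEmbedding_vec2, Measure.volume_eq_prod,
    integral_prod_symm _ hint]
  refine integral_congr_ae (.of_forall fun b => ?_)
  simp [inner_vec2, Circle.smul_def, integral_smul, mul_comm]

lemma integrable_integral_vec2 {f : EuclideanSpace ℝ (Fin 2) → E} (hf : Integrable f) :
    Integrable fun b : ℝ => ∫ ξ : ℝ, f (vec2 ξ b) :=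
  Integrable.integral_prod_right
    ((measurePreserving_vec2.integrable_comp_emb measurableEmbedding_vec2).2 hf)

lemma norm_fst_le_norm_vec2 (a b : ℝ) : ‖a‖ ≤ ‖vec2 a b‖ := by
  simpa [vec2] using PiLp.norm_apply_le (vec2 a b) 0

lemma norm_snd_le_norm_vec2 (a b : ℝ) : ‖b‖ ≤ ‖vec2 a b‖ := by
  simpa [vec2] using PiLp.norm_apply_le (vec2 a b) 1

lemma memLp_integral_vec2 {f : EuclideanSpace ℝ (Fin 2) → E} (hf : Continuous f)
    (hfc : HasCompactSupport f) (p : ENNReal) :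
    MemLp (fun b : ℝ => ∫ ξ : ℝ, f (vec2 ξ b)) p := by
  obtain ⟨R, hR⟩ := hfc.isCompact.isBounded.exists_norm_le
  have hzero {a b : ℝ} (h : R < ‖a‖ ∨ R < ‖b‖) : f (vec2 a b) = 0 := by
    by_contra hne
    have := hR _ (subset_tsupport f hne)
    rcases h with h | h
    · linarith [norm_fst_le_norm_vec2 a b]
    · linarith [norm_snd_le_norm_vec2 a b]
  have hcont : Continuous fun b : ℝ => ∫ ξ : ℝ, f (vec2 ξ b) := by
    rw [← continuousOn_univ]
    refine continuousOn_integral_of_compact_support (isCompact_closedBall (0 : ℝ) R) ?_ ?_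
    · exact (hf.comp (continuous_vec2.comp continuous_swap)).continuousOn
    · intro b a _ ha
      exact hzero (.inl (by simpa using ha))
  refine hcont.memLp_of_hasCompactSupport
    (HasCompactSupport.intro (isCompact_closedBall (0 : ℝ) R) fun b hb => ?_)
  have hb' : R < ‖b‖ := by simpa using hb
  simp [hzero (.inr hb')]

end FourierSlice

lemma fourier_fderiv_apply {V E : Type*} [NormedAddCommGroup V] [InnerProductSpace ℝ V]
    [FiniteDimensional ℝ V] [MeasurableSpace V] [BorelSpace V] [NormedAddCommGroup E]
    [NormedSpace ℂ E] {f : V → E} (hf : ContDiff ℝ 1 f) (hfc : HasCompactSupport f) (v w : V) :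
    𝓕 (fun x => fderiv ℝ f x v) w = (2 * Real.pi * Complex.I * ⟪v, w⟫ : ℂ) • 𝓕 f w := by
  have hint : Integrable (fderiv ℝ f) :=
    (hf.continuous_fderiv one_ne_zero).integrable_of_hasCompactSupport (hfc.fderiv ℝ)
  rw [← Real.fourier_continuousLinearMap_apply hint, Real.fourier_fderiv
    (hf.continuous.integrable_of_hasCompactSupport hfc) (hf.differentiable one_ne_zero) hint]
  simp [VectorFourier.fourierSMulRight_apply, mul_smul]
  rw [innerSL_apply_apply, real_inner_comm]

/-- Plancherel/Fourier-slice identity: for a compactly supported `C¹` function `W` on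
`ℝ²`, the square integral of the X-ray transform of `∂₂W` along horizontal lines equals
`4π² ∫ k² ‖𝓕W((0,k))‖² dk`. -/
theorem xray_plancherel (W : EuclideanSpace ℝ (Fin 2) → ℝ)
    (hW : ContDiff ℝ 1 W) (hsupp : HasCompactSupport W) :
    ∫ b : ℝ, (∫ ξ : ℝ, fderiv ℝ W (vec2 ξ b) (vec2 0 1))^2
      = 4 * Real.pi^2 *
        ∫ k : ℝ, k^2 * ‖𝓕 (fun y : EuclideanSpace ℝ (Fin 2) => (W y : ℂ)) (vec2 0 k)‖^2 := by
  set f : EuclideanSpace ℝ (Fin 2) → ℂ := fun y => (W y : ℂ) with hf_def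
  have hf : ContDiff ℝ 1 f := Complex.ofRealCLM.contDiff.comp hW
  have hfc : HasCompactSupport f := hsupp.comp_left Complex.ofReal_zero
  set D : EuclideanSpace ℝ (Fin 2) → ℂ := fun x => fderiv ℝ f x (vec2 0 1) with hD_def
  have hD : Continuous D := (hf.continuous_fderiv one_ne_zero).clm_apply continuous_const
  have hDc : HasCompactSupport D := hfc.fderiv_apply ℝ _
  have hD_int : Integrable D := hD.integrable_of_hasCompactSupport hDc
  have hDW (x : EuclideanSpace ℝ (Fin 2)) : D x = (fderiv ℝ W x (vec2 0 1) : ℝ) := by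
    have h : HasFDerivAt f (Complex.ofRealCLM.comp (fderiv ℝ W x)) x :=
      Complex.ofRealCLM.hasFDerivAt.comp x (hW.differentiable one_ne_zero x).hasFDerivAt
    simp [hD_def, h.fderiv]
  calc
    _ = ∫ b : ℝ, ‖∫ ξ : ℝ, D (vec2 ξ b)‖ ^ 2 := by
      simp_rw [hDW, integral_complex_ofReal, Complex.norm_real, Real.norm_eq_abs, sq_abs]
    _ = ∫ k : ℝ, ‖𝓕 (fun b : ℝ => ∫ ξ : ℝ, D (vec2 ξ b)) k‖ ^ 2 :=
      (integral_norm_sq_fourier_eq (integrable_integral_vec2 hD_int)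
        (memLp_integral_vec2 hD hDc 2)).symm
    _ = _ := by
      rw [← integral_const_mul]
      refine integral_congr_ae (.of_forall fun k => ?_)
      simp only [fourier_integral_vec2 hD_int]
      rw [hD_def, fourier_fderiv_apply hf hfc, inner_vec2, norm_smul, mul_pow]
      simp [mul_pow]
      ring
end

section
/- Let n ≥ 1 be a natural number, and let ρ > 0, T > 0, α > 0. Then there exists a constant C > 0 (depending only on n, ρ, T, α) such that for all ε ∈ (0, 1] and all t ∈ (0, T]: exp(−2ρ t ε^{−2α}) · ε^n · ∑_{j=0}^{∞} (2ρ ε^{−2α})^{n+j} · (n+j)^{n+2} · t^{n+j−1} / j! ≤ C · ε^{n − 4(n+1)α}. -/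
/-- Shifted Poisson moments: the `m`-th moment of `c + N`, with `N` Poisson of parameter `x`, is
finite and at most `(x + c + m) ^ m`. -/
theorem exists_hasSum_pow_mul_shift_pow_div_factorial_le (x : ℝ) (hx : 0 ≤ x) (m : ℕ) :
    ∀ c : ℕ, ∃ s : ℝ,
      HasSum (fun j : ℕ => x ^ j * ((c + j : ℕ) : ℝ) ^ m / (Nat.factorial j : ℝ)) s ∧
        s ≤ (x + c + m) ^ m * Real.exp x := by
  induction m with
  | zero =>
    intro c
    refine ⟨Real.exp x, ?_, by simp⟩
    simpa [Real.exp_eq_exp_ℝ] using NormedSpace.expSeries_div_hasSum_exp x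
  | succ m ih =>
    intro c
    obtain ⟨s, hs, hsle⟩ := ih c
    obtain ⟨r, hr, hrle⟩ := ih (c + 1)
    have hshift : HasSum (fun j : ℕ => (j : ℝ) * (x ^ j * ((c + j : ℕ) : ℝ) ^ m /
        (Nat.factorial j : ℝ))) (x * r) := by
      rw [← hasSum_nat_add_iff' 1]
      simp only [Finset.range_one, Finset.sum_singleton, Nat.cast_zero, zero_mul, sub_zero]
      refine (hr.mul_left x).congr_fun fun j => ?_
      have : ((j : ℝ) + 1) ≠ 0 := by positivity
      have hf : (Nat.factorial j : ℝ) ≠ 0 := by positivity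
      rw [Nat.factorial_succ]
      push_cast
      field_simp
      ring
    refine ⟨c * s + x * r, ?_, ?_⟩
    · refine ((hs.mul_left (c : ℝ)).add hshift).congr_fun fun j => ?_
      push_cast
      ring
    · have h1 : s ≤ (x + c + (m + 1)) ^ m * Real.exp x :=
        hsle.trans (by gcongr; linarith)
      have h2 : r ≤ (x + c + (m + 1)) ^ m * Real.exp x := by
        refine hrle.trans (le_of_eq ?_)
        push_cast
        ring
      calc c * s + x * r
          ≤ c * ((x + c + (m + 1)) ^ m * Real.exp x) +
              x * ((x + c + (m + 1)) ^ m * Real.exp x) := by gcongr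
        _ = (x + c) * ((x + c + (m + 1)) ^ m * Real.exp x) := by ring
        _ ≤ (x + c + (m + 1)) * ((x + c + (m + 1)) ^ m * Real.exp x) := by
            have : (0 : ℝ) ≤ m := by positivity
            exact mul_le_mul_of_nonneg_right (by linarith) (by positivity)
        _ = (x + c + (m + 1 : ℕ)) ^ (m + 1) * Real.exp x := by push_cast; ring


/-- Final series estimate of the Appendix: with obstacle intensity `ρ ε^{−2α−1}`, the
recollision error series is bounded by `C ε^{n − 4(n+1)α}`. -/
theorem appendix_series_estimate (n : ℕ) (hn : 1 ≤ n) (ρ T α : ℝ)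
    (hρ : 0 < ρ) (hT : 0 < T) (hα : 0 < α) :
    ∃ C > (0:ℝ), ∀ ε ∈ Set.Ioc (0:ℝ) 1, ∀ t ∈ Set.Ioc (0:ℝ) T,
      Real.exp (-(2 * ρ * t * ε ^ (-(2 * α)))) * ε ^ n *
          ∑' j : ℕ, (2 * ρ * ε ^ (-(2 * α))) ^ (n + j) * ((n + j : ℕ) : ℝ) ^ (n + 2)
            * t ^ (n + j - 1) / (Nat.factorial j : ℝ)
        ≤ C * ε ^ ((n : ℝ) - 4 * ((n : ℝ) + 1) * α) := by
  refine ⟨(2 * ρ) ^ n * T ^ (n - 1) * (2 * ρ * T + n + (n + 2)) ^ (n + 2), by positivity, ?_⟩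
  rintro ε ⟨hε, hε1⟩ t ⟨ht, htT⟩
  have hu1 : 1 ≤ ε ^ (-(2 * α)) :=
    Real.one_le_rpow_of_pos_of_le_one_of_nonpos hε hε1 (by linarith)
  have hpow : ε ^ ((n : ℝ) - 4 * ((n : ℝ) + 1) * α) =
      ε ^ n * (ε ^ (-(2 * α))) ^ n * (ε ^ (-(2 * α))) ^ (n + 2) := by
    rw [← Real.rpow_natCast ε n, ← Real.rpow_mul_natCast hε.le, ← Real.rpow_mul_natCast hε.le,
      ← Real.rpow_add hε, ← Real.rpow_add hε]
    congr 1
    push_cast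
    ring
  rw [hpow]
  generalize ε ^ (-(2 * α)) = u at hu1
  have hu : 0 < u := by linarith
  obtain ⟨s, hs, hsle⟩ :=
    exists_hasSum_pow_mul_shift_pow_div_factorial_le (2 * ρ * t * u) (by positivity) (n + 2) n
  have hsum : ∑' j : ℕ, (2 * ρ * u) ^ (n + j) * ((n + j : ℕ) : ℝ) ^ (n + 2)
      * t ^ (n + j - 1) / (Nat.factorial j : ℝ) = (2 * ρ * u) ^ n * t ^ (n - 1) * s := by
    rw [← (hs.mul_left ((2 * ρ * u) ^ n * t ^ (n - 1))).tsum_eq]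
    congr 1
    funext j
    rw [show n + j - 1 = (n - 1) + j by omega, pow_add _ n j, pow_add t,
      show 2 * ρ * t * u = (2 * ρ * u) * t by ring, mul_pow (2 * ρ * u) t j]
    ring
  have hbase : 2 * ρ * t * u + n + (n + 2 : ℕ) ≤ (2 * ρ * T + n + (n + 2)) * u := by
    have h1 : 2 * ρ * t * u ≤ 2 * ρ * T * u := by gcongr
    have h2 : ((n : ℝ) + (n + 2)) * 1 ≤ (n + (n + 2)) * u := by gcongr
    push_cast
    linarith
  rw [hsum]
  calc Real.exp (-(2 * ρ * t * u)) * ε ^ n * ((2 * ρ * u) ^ n * t ^ (n - 1) * s)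
      ≤ Real.exp (-(2 * ρ * t * u)) * ε ^ n * ((2 * ρ * u) ^ n * T ^ (n - 1) *
          (((2 * ρ * T + n + (n + 2)) * u) ^ (n + 2) * Real.exp (2 * ρ * t * u))) := by
        have hs' : s ≤ ((2 * ρ * T + n + (n + 2)) * u) ^ (n + 2) * Real.exp (2 * ρ * t * u) :=
          hsle.trans (by gcongr)
        have hs0 : 0 ≤ s := hs.nonneg fun j => by positivity
        gcongr
    _ = (Real.exp (-(2 * ρ * t * u)) * Real.exp (2 * ρ * t * u)) *
          ((2 * ρ) ^ n * T ^ (n - 1) * (2 * ρ * T + n + (n + 2)) ^ (n + 2) *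
            (ε ^ n * u ^ n * u ^ (n + 2))) := by
        rw [mul_pow (2 * ρ) u, mul_pow _ u (n + 2)]
        ring
    _ = _ := by rw [← Real.exp_add, neg_add_cancel, Real.exp_zero, one_mul]
end
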